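/- Let L > 0, M ∈ ℕ, a_0, …, a_M ∈ ℂ, s ∈ (0, π), x = L·cot(s), and let P ∈ ℕ with P ≥ 2M+1. Define b̃_l = (8l+4)·a_l for 0 ≤ l ≤ M and b̃_l = 0 for M+1 ≤ l ≤ P−1; define c̃_0 = 1/3, c̃_l = 0 for 1 ≤ l ≤ P−M−1, and c̃_l = 1/((2(l−P)−3)(2(l−P)−1)(2(l−P)+1)) for P−M ≤ l ≤ P−1; and set (b̃∗c̃)_l = ∑_{n=0}^{P−1} b̃_n·c̃_{(l−n) mod P} (indices of c̃ taken modulo P in {0,…,P−1}). Then ∑_{l=0}^{M} a_l·(1/π)·PV∫ u_{2l+1}'(y)/(x−y) dy = −(2i/(Lπ))·∑_{l=0}^{M} a_l/(2l+3) + (2i/(Lπ))·∑_{l=0}^{M} (b̃∗c̃)_l·e^{i2ls} − (2i/(Lπ))·( cos(s) + sin²(s)·ln(cot(s/2)) )·∑_{l=0}^{M} (2l+1)·a_l·e^{i(2l+1)s}; in particular each principal value on the left exists. -/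

import Mathlib

open Filter MeasureTheory

/-- `u_k(y) = (y+iL)^k/(y²+L²)^{k/2}`, with `(y+iL)^k` a `zpow` in `ℂ` and `(y²+L²)^{k/2}` a
real power; for `x = L·cot s`, `(1/π)·PV∫ u_k'(y)/(x−y) dy` is `(−Δ)_s^{1/2} e^{iks}`. -/
noncomputable def uFunL (L : ℝ) (k : ℤ) (y : ℝ) : ℂ :=
  ((y : ℂ) + Complex.I * (L : ℂ)) ^ k / ((((y ^ 2 + L ^ 2 : ℝ) ^ ((k : ℝ) / 2) : ℝ)) : ℂ)

open Topology

/-- `f` is integrable away from `x` and its symmetrically truncated integrals around `x`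
converge to `v`. -/
def HasPrincipalValue (f : ℝ → ℂ) (x : ℝ) (v : ℂ) : Prop :=
  (∀ ε : ℝ, 0 < ε → IntegrableOn f {y : ℝ | ε ≤ |x - y|}) ∧
    Tendsto (fun ε : ℝ => ∫ y in {y : ℝ | ε ≤ |x - y|}, f y) (𝓝[>] 0) (𝓝 v)

lemma measurableSet_le_abs_sub (x ε : ℝ) : MeasurableSet {y : ℝ | ε ≤ |x - y|} :=
  measurableSet_le measurable_const (by fun_prop)

namespace HasPrincipalValue

variable {f g : ℝ → ℂ} {x : ℝ} {v w : ℂ}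

lemma congr (hf : HasPrincipalValue f x v) (h : ∀ y, y ≠ x → f y = g y) :
    HasPrincipalValue g x v := by
  have key : ∀ ε : ℝ, 0 < ε → Set.EqOn f g {y : ℝ | ε ≤ |x - y|} := by
    intro ε hε y hy
    refine h y ?_
    rintro rfl
    simp only [Set.mem_ofPred_eq, sub_self, abs_zero] at hy
    linarith
  refine ⟨fun ε hε => (hf.1 ε hε).congr_fun (key ε hε) (measurableSet_le_abs_sub x ε),
    hf.2.congr' ?_⟩
  filter_upwards [self_mem_nhdsWithin] with ε hε
  exact setIntegral_congr_fun (measurableSet_le_abs_sub x ε) (key ε hε)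

lemma add (hf : HasPrincipalValue f x v) (hg : HasPrincipalValue g x w) :
    HasPrincipalValue (fun y => f y + g y) x (v + w) := by
  refine ⟨fun ε hε => (hf.1 ε hε).add (hg.1 ε hε), (hf.2.add hg.2).congr' ?_⟩
  filter_upwards [self_mem_nhdsWithin] with ε hε
  exact (integral_add (hf.1 ε hε) (hg.1 ε hε)).symm

lemma const_mul (c : ℂ) (hf : HasPrincipalValue f x v) :
    HasPrincipalValue (fun y => c * f y) x (c * v) := by
  refine ⟨fun ε hε => (hf.1 ε hε).const_mul c, (hf.2.const_mul c).congr fun ε => ?_⟩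
  exact (integral_const_mul c _).symm

end HasPrincipalValue

lemma MeasureTheory.Integrable.hasPrincipalValue {f : ℝ → ℂ} (hf : Integrable f) (x : ℝ) :
    HasPrincipalValue f x (∫ y, f y) := by
  refine ⟨fun ε _ => hf.integrableOn, ?_⟩
  simp_rw [← integral_indicator (measurableSet_le_abs_sub x _)]
  refine tendsto_integral_filter_of_dominated_convergence (fun y => ‖f y‖) ?_ ?_ hf.norm ?_
  · exact Eventually.of_forall fun ε =>
      hf.aestronglyMeasurable.indicator (measurableSet_le_abs_sub x ε)
  · exact Eventually.of_forall fun ε => Eventually.of_forall fun y =>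
      norm_indicator_le_norm_self _ _
  · filter_upwards [compl_mem_ae_iff.mpr (measure_singleton x)] with y hy
    have hpos : 0 < |x - y| := abs_pos.mpr (sub_ne_zero.mpr fun h => hy h.symm)
    refine tendsto_const_nhds.congr' ?_
    filter_upwards [nhdsWithin_le_nhds (Iio_mem_nhds hpos)] with ε hε
    have hle : ε ≤ |x - y| := le_of_lt hε
    have hmem : y ∈ {y : ℝ | ε ≤ |x - y|} := hle
    exact (Set.indicator_of_mem hmem f).symm

/-- A principal value computed from an antiderivative on the punctured line. -/
lemma hasPrincipalValue_of_hasDerivAt {F f : ℝ → ℂ} {x : ℝ} {A B : ℂ}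
    (hint : ∀ ε : ℝ, 0 < ε → IntegrableOn f {y : ℝ | ε ≤ |x - y|})
    (hF : ∀ y, y ≠ x → HasDerivAt F (f y) y)
    (hA : Tendsto F atBot (𝓝 A)) (hB : Tendsto F atTop (𝓝 B))
    (hx : Tendsto (fun ε => F (x - ε) - F (x + ε)) (𝓝[>] 0) (𝓝 0)) :
    HasPrincipalValue f x (B - A) := by
  refine ⟨hint, ?_⟩
  have h : Tendsto (fun ε => (F (x - ε) - F (x + ε)) + (B - A)) (𝓝[>] 0) (𝓝 (B - A)) := by
    simpa using hx.add_const (B - A)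
  refine h.congr' ?_
  filter_upwards [self_mem_nhdsWithin] with ε hε
  have hε : 0 < ε := hε
  have hset : {y : ℝ | ε ≤ |x - y|} = Set.Iic (x - ε) ∪ Set.Ici (x + ε) := by
    ext y
    simp only [Set.mem_ofPred_eq, Set.mem_union, Set.mem_Iic, Set.mem_Ici, le_abs]
    constructor <;> rintro (h | h) <;> [left; right; left; right] <;> linarith
  have hi := hint ε hε
  rw [hset] at hi ⊢
  have h1 := hi.mono_set Set.subset_union_left
  have h2 := hi.mono_set Set.subset_union_right
  rw [setIntegral_union (Set.disjoint_left.mpr fun y h h' => by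
      simp only [Set.mem_Iic, Set.mem_Ici] at h h'; linarith) measurableSet_Ici h1 h2,
    integral_Iic_of_hasDerivAt_of_tendsto' (fun y hy => hF y (by
      rintro rfl; simp only [Set.mem_Iic] at hy; linarith)) h1 hA,
    integral_Ici_eq_integral_Ioi,
    integral_Ioi_of_hasDerivAt_of_tendsto' (fun y hy => hF y (by
      rintro rfl; simp only [Set.mem_Ici] at hy; linarith))
      (h2.mono_set Set.Ioi_subset_Ici_self) hB]
  ring

section

variable {L : ℝ}

lemma sqrt_sq_add_sq_pos (hL : 0 < L) (y : ℝ) : 0 < √(y ^ 2 + L ^ 2) :=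
  Real.sqrt_pos.mpr (by positivity)

lemma ofReal_add_I_mul_ne_zero (hL : 0 < L) (y : ℝ) : (y : ℂ) + Complex.I * L ≠ 0 := by
  intro h
  have := congrArg Complex.im h
  simp at this
  exact hL.ne' this

lemma ofReal_sub_I_mul_ne_zero (hL : 0 < L) (y : ℝ) : (y : ℂ) - Complex.I * L ≠ 0 := by
  intro h
  have := congrArg Complex.im h
  simp at this
  exact hL.ne' this

lemma add_I_mul_mul_sub_I_mul (L y : ℝ) :
    ((y : ℂ) + Complex.I * L) * ((y : ℂ) - Complex.I * L) = (y : ℂ) ^ 2 + (L : ℂ) ^ 2 := by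
  linear_combination -(L : ℂ) ^ 2 * Complex.I_sq

lemma ofReal_sqrt_sq (L y : ℝ) :
    ((√(y ^ 2 + L ^ 2) : ℝ) : ℂ) ^ 2 = (y : ℂ) ^ 2 + (L : ℂ) ^ 2 := by
  rw [← Complex.ofReal_pow, Real.sq_sqrt (by positivity)]
  push_cast
  ring

lemma uFunL_odd (hL : 0 < L) (l : ℕ) (y : ℝ) :
    uFunL L (2 * (l : ℤ) + 1) y = ((y : ℂ) + Complex.I * L) / (√(y ^ 2 + L ^ 2) : ℝ)
      * (((y : ℂ) + Complex.I * L) / ((y : ℂ) - Complex.I * L)) ^ l := by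
  have hr : (y ^ 2 + L ^ 2 : ℝ) ^ (((2 * (l : ℤ) + 1 : ℤ) : ℝ) / 2)
      = √(y ^ 2 + L ^ 2) ^ (2 * l + 1) := by
    rw [Real.sqrt_eq_rpow, ← Real.rpow_natCast (_ ^ (1 / 2 : ℝ)), ← Real.rpow_mul (by positivity)]
    congr 1
    push_cast
    ring
  have hr0 : ((√(y ^ 2 + L ^ 2) : ℝ) : ℂ) ≠ 0 :=
    Complex.ofReal_ne_zero.mpr (sqrt_sq_add_sq_pos hL y).ne'
  have hz := ofReal_add_I_mul_ne_zero hL y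
  have hz' := ofReal_sub_I_mul_ne_zero hL y
  have hV : ((y : ℂ) + Complex.I * L) / ((y : ℂ) - Complex.I * L)
      = (((y : ℂ) + Complex.I * L) / (√(y ^ 2 + L ^ 2) : ℝ)) ^ 2 := by
    rw [div_pow, ofReal_sqrt_sq, ← add_I_mul_mul_sub_I_mul]
    field_simp
  rw [uFunL, hr, hV, ← pow_mul, ← pow_succ', div_pow, Complex.ofReal_pow]
  congr 1

lemma uFunL_odd_succ (hL : 0 < L) (l : ℕ) (y : ℝ) :
    uFunL L (2 * ((l + 1 : ℕ) : ℤ) + 1) y = uFunL L (2 * (l : ℤ) + 1) y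
      * (((y : ℂ) + Complex.I * L) / ((y : ℂ) - Complex.I * L)) := by
  rw [uFunL_odd hL, uFunL_odd hL, pow_succ]
  ring

lemma norm_ofReal_sub_I_mul (L y : ℝ) : ‖(y : ℂ) - Complex.I * L‖ = √(y ^ 2 + L ^ 2) := by
  have := Complex.norm_add_mul_I y (-L)
  rw [neg_sq] at this
  rw [← this]
  congr 1
  push_cast
  ring

lemma norm_uFunL_odd (hL : 0 < L) (l : ℕ) (y : ℝ) : ‖uFunL L (2 * (l : ℤ) + 1) y‖ = 1 := by
  have h1 : ‖(y : ℂ) + Complex.I * L‖ = √(y ^ 2 + L ^ 2) := by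
    rw [mul_comm, Complex.norm_add_mul_I]
  have := (sqrt_sq_add_sq_pos hL y).ne'
  rw [uFunL_odd hL, norm_mul, norm_pow, norm_div, norm_div, h1, norm_ofReal_sub_I_mul, Complex.norm_real,
    Real.norm_of_nonneg (Real.sqrt_nonneg _), div_self this, one_pow, one_mul]

lemma hasDerivAt_sqrt_sq_add_sq (hL : 0 < L) (y : ℝ) :
    HasDerivAt (fun y : ℝ => √(y ^ 2 + L ^ 2)) (y / √(y ^ 2 + L ^ 2)) y := by
  have h := ((hasDerivAt_pow 2 y).add_const (L ^ 2)).sqrt (by positivity)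
  refine h.congr_deriv ?_
  push_cast
  field_simp

lemma hasDerivAt_uFunL_odd (hL : 0 < L) (l : ℕ) (y : ℝ) :
    HasDerivAt (uFunL L (2 * (l : ℤ) + 1))
      (-Complex.I * (2 * l + 1) * (uFunL L (2 * (l : ℤ) + 1) y * (L / (y ^ 2 + L ^ 2)))) y := by
  have hr0 : ((√(y ^ 2 + L ^ 2) : ℝ) : ℂ) ≠ 0 :=
    Complex.ofReal_ne_zero.mpr (sqrt_sq_add_sq_pos hL y).ne'
  have hz := ofReal_add_I_mul_ne_zero hL y
  have hz' := ofReal_sub_I_mul_ne_zero hL y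
  have hy : HasDerivAt (fun y : ℝ => (y : ℂ)) 1 y := Complex.ofRealCLM.hasDerivAt
  induction l with
  | zero =>
    have hs := (hasDerivAt_sqrt_sq_add_sq hL y).ofReal_comp
    have h := (hy.add_const (Complex.I * L)).fun_div hs hr0
    refine (h.congr_of_eventuallyEq (Eventually.of_forall fun t => ?_)).congr_deriv ?_
    · rw [uFunL_odd hL, pow_zero, mul_one]
    · rw [uFunL_odd hL, ← ofReal_sqrt_sq]
      have e := ofReal_sqrt_sq L y
      rw [Complex.ofReal_div]
      generalize ((√(y ^ 2 + L ^ 2) : ℝ) : ℂ) = r at *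
      rw [pow_zero, mul_one]
      push_cast
      field_simp
      linear_combination e + (L : ℂ) ^ 2 * Complex.I_sq
  | succ l ih =>
    have hV := (hy.add_const (Complex.I * L)).fun_div (hy.sub_const (Complex.I * L)) hz'
    refine ((ih.fun_mul hV).congr_of_eventuallyEq (Eventually.of_forall fun t => ?_)).congr_deriv ?_
    · exact uFunL_odd_succ hL l t
    · rw [uFunL_odd_succ hL, ← add_I_mul_mul_sub_I_mul]
      generalize uFunL L (2 * (l : ℤ) + 1) y = u
      push_cast
      field_simp
      ring


lemma integrable_div_sq_add_sq (hL : 0 < L) : Integrable fun y : ℝ => L / (y ^ 2 + L ^ 2) := by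
  have h := (integrable_inv_one_add_sq.comp_div hL.ne').const_mul L⁻¹
  refine h.congr (Eventually.of_forall fun y => ?_)
  simp only
  field_simp
  ring

lemma tendsto_sqrt_sq_add_sq_div_atTop (L : ℝ) :
    Tendsto (fun y : ℝ => √(y ^ 2 + L ^ 2) / y) atTop (𝓝 1) := by
  have h : Tendsto (fun y : ℝ => √(1 + (L / y) ^ 2)) atTop (𝓝 √(1 + 0 ^ 2)) :=
    (((tendsto_const_nhds.div_atTop tendsto_id).pow 2).const_add 1).sqrt
  norm_num at h
  refine h.congr' ?_
  filter_upwards [eventually_gt_atTop 0] with y hy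
  rw [eq_div_iff hy.ne']
  nth_rewrite 2 [← Real.sqrt_sq hy.le]
  rw [← Real.sqrt_mul (by positivity)]
  congr 1
  field_simp

lemma tendsto_div_sqrt_sq_add_sq_atTop (L : ℝ) :
    Tendsto (fun y : ℝ => y / √(y ^ 2 + L ^ 2)) atTop (𝓝 1) := by
  simpa using (tendsto_sqrt_sq_add_sq_div_atTop L).inv₀ one_ne_zero

lemma tendsto_div_sqrt_sq_add_sq_atBot (L : ℝ) :
    Tendsto (fun y : ℝ => y / √(y ^ 2 + L ^ 2)) atBot (𝓝 (-1)) := by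
  have h := ((tendsto_div_sqrt_sq_add_sq_atTop L).comp tendsto_neg_atBot_atTop).neg
  refine h.congr fun y => ?_
  simp [neg_div]

lemma tendsto_inv_sqrt_sq_add_sq (L : ℝ) {l : Filter ℝ}
    (hl : Tendsto (fun y : ℝ => |y|) l atTop) :
    Tendsto (fun y : ℝ => (√(y ^ 2 + L ^ 2))⁻¹) l (𝓝 0) := by
  refine tendsto_inv_atTop_zero.comp (tendsto_atTop_mono (fun y => ?_) hl)
  exact Real.abs_le_sqrt (by nlinarith [sq_nonneg L])

lemma tendsto_uFunL_odd (hL : 0 < L) (l : ℕ) {F : Filter ℝ} {c : ℝ}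
    (hF : Tendsto (fun y : ℝ => |y|) F atTop)
    (hc : Tendsto (fun y : ℝ => y / √(y ^ 2 + L ^ 2)) F (𝓝 c)) :
    Tendsto (uFunL L (2 * (l : ℤ) + 1)) F (𝓝 c) := by
  have h1 : Tendsto (fun y : ℝ => ((y : ℂ) + Complex.I * L) / (√(y ^ 2 + L ^ 2) : ℝ)) F
      (𝓝 (c + Complex.I * L * (0 : ℝ))) := by
    have h0 := ((Complex.continuous_ofReal.tendsto _).comp
      (tendsto_inv_sqrt_sq_add_sq L hF)).const_mul (Complex.I * L)
    refine (((Complex.continuous_ofReal.tendsto _).comp hc).add h0).congr fun y => ?_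
    simp only [Function.comp_apply]
    push_cast
    ring
  have h2 : Tendsto (fun y : ℝ => ((y : ℂ) + Complex.I * L) / ((y : ℂ) - Complex.I * L)) F
      (𝓝 1) := by
    have h0 : Tendsto (fun y : ℝ => ((y : ℂ) - Complex.I * L)⁻¹) F (𝓝 0) := by
      rw [tendsto_zero_iff_norm_tendsto_zero]
      simpa only [norm_inv, norm_ofReal_sub_I_mul] using tendsto_inv_sqrt_sq_add_sq L hF
    have h3 := (h0.const_mul (2 * Complex.I * L)).const_add 1
    rw [mul_zero, add_zero] at h3
    refine h3.congr fun y => ?_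
    have := ofReal_sub_I_mul_ne_zero hL y
    field_simp
    ring
  have h3 := h1.mul (h2.pow l)
  simp only [Complex.ofReal_zero, mul_zero, add_zero, one_pow, mul_one] at h3
  exact h3.congr fun y => (uFunL_odd hL l y).symm

lemma tendsto_uFunL_odd_atTop (hL : 0 < L) (l : ℕ) :
    Tendsto (uFunL L (2 * (l : ℤ) + 1)) atTop (𝓝 1) := by
  simpa using tendsto_uFunL_odd hL l tendsto_abs_atTop_atTop (tendsto_div_sqrt_sq_add_sq_atTop L)

lemma tendsto_uFunL_odd_atBot (hL : 0 < L) (l : ℕ) :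
    Tendsto (uFunL L (2 * (l : ℤ) + 1)) atBot (𝓝 (-1)) := by
  simpa using tendsto_uFunL_odd hL l tendsto_abs_atBot_atTop (tendsto_div_sqrt_sq_add_sq_atBot L)

lemma continuous_uFunL_odd (hL : 0 < L) (l : ℕ) : Continuous (uFunL L (2 * (l : ℤ) + 1)) :=
  continuous_iff_continuousAt.mpr fun y => (hasDerivAt_uFunL_odd hL l y).continuousAt

lemma integrable_uFunL_odd_mul (hL : 0 < L) (l : ℕ) :
    Integrable fun y : ℝ => uFunL L (2 * (l : ℤ) + 1) y * (L / (y ^ 2 + L ^ 2)) := by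
  have h := (integrable_div_sq_add_sq hL).ofReal (𝕜 := ℂ)
  refine (h.bdd_mul (c := 1) (continuous_uFunL_odd hL l).aestronglyMeasurable
    (Eventually.of_forall fun y => (norm_uFunL_odd hL l y).le)).congr
    (Eventually.of_forall fun y => ?_)
  simp

lemma integral_uFunL_odd_mul (hL : 0 < L) (l : ℕ) :
    ∫ y : ℝ, uFunL L (2 * (l : ℤ) + 1) y * (L / (y ^ 2 + L ^ 2))
      = 2 * Complex.I / (2 * l + 1) := by
  have hk : (2 * l + 1 : ℂ) ≠ 0 := by exact_mod_cast (2 * l).succ_ne_zero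
  rw [integral_of_hasDerivAt_of_tendsto
    (fun y => ((hasDerivAt_uFunL_odd hL l y).const_mul (Complex.I / (2 * l + 1))).congr_deriv ?_)
    (integrable_uFunL_odd_mul hL l) ((tendsto_uFunL_odd_atBot hL l).const_mul _)
    ((tendsto_uFunL_odd_atTop hL l).const_mul _)]
  · ring
  · field_simp
    linear_combination -uFunL L (2 * (l : ℤ) + 1) y * (L / (y ^ 2 + L ^ 2)) * Complex.I_sq

/-- The principal values of `u_{2l+1}(y) L / ((y² + L²) (x - y))` satisfy a first-order recursion
in `l`. -/
lemma HasPrincipalValue.uFunL_odd_succ (hL : 0 < L) (l : ℕ) {x : ℝ} {K : ℂ}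
    (h : HasPrincipalValue
      (fun y => uFunL L (2 * (l : ℤ) + 1) y * (L / (y ^ 2 + L ^ 2)) / ((x : ℂ) - y)) x K) :
    HasPrincipalValue
      (fun y => uFunL L (2 * ((l + 1 : ℕ) : ℤ) + 1) y * (L / (y ^ 2 + L ^ 2)) / ((x : ℂ) - y)) x
      (((x : ℂ) + Complex.I * L) / ((x : ℂ) - Complex.I * L) * K
        - 4 * Complex.I / (((x : ℂ) - Complex.I * L) * (2 * l + 1) * (2 * l + 3))) := by
  have hd := ((integrable_uFunL_odd_mul hL (l + 1)).sub
    (integrable_uFunL_odd_mul hL l)).hasPrincipalValue x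
  have hI : ∫ y : ℝ, ((fun y : ℝ => uFunL L (2 * ((l + 1 : ℕ) : ℤ) + 1) y * (L / (y ^ 2 + L ^ 2)))
      - fun y : ℝ => uFunL L (2 * (l : ℤ) + 1) y * (L / (y ^ 2 + L ^ 2))) y
      = 2 * Complex.I / (2 * l + 3) - 2 * Complex.I / (2 * l + 1) := by
    simp only [Pi.sub_apply]
    rw [integral_sub (integrable_uFunL_odd_mul hL (l + 1)) (integrable_uFunL_odd_mul hL l),
      integral_uFunL_odd_mul hL, integral_uFunL_odd_mul hL]
    push_cast
    ring
  rw [hI] at hd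
  have hx' := ofReal_sub_I_mul_ne_zero hL x
  have hsum := (h.const_mul (((x : ℂ) + Complex.I * L) / ((x : ℂ) - Complex.I * L))).add
    (hd.const_mul (1 / ((x : ℂ) - Complex.I * L)))
  have hk : (2 * l + 1 : ℂ) ≠ 0 := by exact_mod_cast (2 * l).succ_ne_zero
  have hk' : (2 * l + 3 : ℂ) ≠ 0 := by exact_mod_cast (2 * l + 2).succ_ne_zero
  convert hsum.congr (g := fun y => uFunL L (2 * ((l + 1 : ℕ) : ℤ) + 1) y * (L / (y ^ 2 + L ^ 2))
    / ((x : ℂ) - y)) ?_ using 1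
  · field_simp
    ring
  · intro y hy
    have hxy : (x : ℂ) - y ≠ 0 := sub_ne_zero.mpr fun h => hy (Complex.ofReal_injective h).symm
    have hy' := ofReal_sub_I_mul_ne_zero hL y
    have hz := ofReal_add_I_mul_ne_zero hL y
    simp only [Pi.sub_apply, _root_.uFunL_odd_succ hL, ← add_I_mul_mul_sub_I_mul]
    generalize uFunL L (2 * (l : ℤ) + 1) y = u
    field_simp
    ring


lemma add_mul_add_sqrt_mul_sqrt_pos (hL : 0 < L) (x y : ℝ) :
    0 < L ^ 2 + x * y + √(x ^ 2 + L ^ 2) * √(y ^ 2 + L ^ 2) := by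
  have h : |x * y| ≤ √(x ^ 2 + L ^ 2) * √(y ^ 2 + L ^ 2) := by
    rw [abs_mul]
    gcongr <;> exact Real.abs_le_sqrt (by nlinarith [sq_nonneg L])
  have := neg_abs_le (x * y)
  have : 0 < L ^ 2 := by positivity
  linarith

/-- `√(x² + L²)` times an antiderivative of `y ↦ 1 / (√(y² + L²) (x - y))`. -/
noncomputable def logKernel (L x y : ℝ) : ℝ :=
  Real.log (L ^ 2 + x * y + √(x ^ 2 + L ^ 2) * √(y ^ 2 + L ^ 2)) - Real.log (x - y)

lemma hasDerivAt_logKernel (hL : 0 < L) {x y : ℝ} (hy : y ≠ x) :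
    HasDerivAt (logKernel L x) (√(x ^ 2 + L ^ 2) / (√(y ^ 2 + L ^ 2) * (x - y))) y := by
  have hN := (add_mul_add_sqrt_mul_sqrt_pos hL x y).ne'
  have hxy : x - y ≠ 0 := sub_ne_zero.mpr hy.symm
  have hr := (sqrt_sq_add_sq_pos hL y).ne'
  have h := (((((hasDerivAt_id y).const_mul x).const_add (L ^ 2)).fun_add
    ((hasDerivAt_sqrt_sq_add_sq hL y).const_mul √(x ^ 2 + L ^ 2))).log hN).fun_sub
    (((hasDerivAt_id y).const_sub x).log hxy)
  refine h.congr_deriv ?_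
  have e : √(y ^ 2 + L ^ 2) ^ 2 = y ^ 2 + L ^ 2 := Real.sq_sqrt (by positivity)
  have e' : √(x ^ 2 + L ^ 2) ^ 2 = x ^ 2 + L ^ 2 := Real.sq_sqrt (by positivity)
  simp only [id]
  generalize √(y ^ 2 + L ^ 2) = r at *
  generalize √(x ^ 2 + L ^ 2) = R at *
  rw [div_sub_div _ _ hN hxy, div_eq_div_iff (mul_ne_zero hN hxy) (mul_ne_zero hr hxy)]
  field_simp
  linear_combination R * e - r * e'

lemma logKernel_neg (L x y : ℝ) : logKernel L x (-y) = logKernel L (-x) y := by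
  rw [logKernel, logKernel, ← Real.log_neg_eq_log (x - -y)]
  congr 3 <;> ring_nf

lemma tendsto_logKernel_atTop (hL : 0 < L) (x : ℝ) :
    Tendsto (logKernel L x) atTop (𝓝 (Real.log (x + √(x ^ 2 + L ^ 2)))) := by
  have hpos : 0 < x + √(x ^ 2 + L ^ 2) := by
    have : |x| < √(x ^ 2 + L ^ 2) := Real.lt_sqrt_of_sq_lt (by rw [sq_abs]; nlinarith)
    linarith [neg_abs_le x]
  have h1 : Tendsto (fun y : ℝ => L ^ 2 / y + x + √(x ^ 2 + L ^ 2) * (√(y ^ 2 + L ^ 2) / y))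
      atTop (𝓝 (0 + x + √(x ^ 2 + L ^ 2) * 1)) :=
    ((tendsto_const_nhds.div_atTop tendsto_id).add_const x).add
      ((tendsto_sqrt_sq_add_sq_div_atTop L).const_mul _)
  have h2 : Tendsto (fun y : ℝ => 1 - x / y) atTop (𝓝 (1 - 0)) :=
    (tendsto_const_nhds.div_atTop tendsto_id).const_sub 1
  rw [zero_add, mul_one] at h1
  rw [sub_zero] at h2
  have h3 := (h1.div h2 one_ne_zero).log (by simpa using hpos.ne')
  rw [div_one] at h3
  refine h3.congr' ?_
  filter_upwards [eventually_gt_atTop 0, eventually_gt_atTop x] with y hy hxy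
  have hxy' : y - x ≠ 0 := sub_ne_zero.mpr hxy.ne'
  rw [logKernel, ← Real.log_neg_eq_log (x - y), neg_sub,
    ← Real.log_div (add_mul_add_sqrt_mul_sqrt_pos hL x y).ne' hxy']
  congr 1
  have : 1 - x / y ≠ 0 := by
    rw [one_sub_div hy.ne']
    positivity
  simp only [Pi.div_apply]
  rw [div_eq_div_iff this hxy']
  field_simp

lemma tendsto_logKernel_atBot (hL : 0 < L) (x : ℝ) :
    Tendsto (logKernel L x) atBot (𝓝 (Real.log (-x + √(x ^ 2 + L ^ 2)))) := by
  have h := (tendsto_logKernel_atTop hL (-x)).comp tendsto_neg_atBot_atTop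
  rw [neg_sq] at h
  refine h.congr fun y => ?_
  rw [Function.comp_apply, ← logKernel_neg, neg_neg]

/-- An antiderivative of `y ↦ (y² + L²)^{-3/2} / (x - y)`, times `x² + L²`. -/
noncomputable def cubeKernel (L x y : ℝ) : ℝ :=
  (√(x ^ 2 + L ^ 2))⁻¹ * logKernel L x y + x / L ^ 2 * (y / √(y ^ 2 + L ^ 2))
    - (√(y ^ 2 + L ^ 2))⁻¹

lemma hasDerivAt_div_sqrt_sq_add_sq (hL : 0 < L) (y : ℝ) :
    HasDerivAt (fun y : ℝ => y / √(y ^ 2 + L ^ 2)) (L ^ 2 / √(y ^ 2 + L ^ 2) ^ 3) y := by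
  have hr := (sqrt_sq_add_sq_pos hL y).ne'
  have e : √(y ^ 2 + L ^ 2) ^ 2 = y ^ 2 + L ^ 2 := Real.sq_sqrt (by positivity)
  refine ((hasDerivAt_id y).fun_div (hasDerivAt_sqrt_sq_add_sq hL y) hr).congr_deriv ?_
  simp only [id]
  generalize √(y ^ 2 + L ^ 2) = r at *
  field_simp
  linear_combination e

lemma hasDerivAt_cubeKernel (hL : 0 < L) {x y : ℝ} (hy : y ≠ x) :
    HasDerivAt (cubeKernel L x) ((x ^ 2 + L ^ 2) / (√(y ^ 2 + L ^ 2) ^ 3 * (x - y))) y := by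
  have hxy : x - y ≠ 0 := sub_ne_zero.mpr hy.symm
  have hr := (sqrt_sq_add_sq_pos hL y).ne'
  have hR := (sqrt_sq_add_sq_pos hL x).ne'
  have h := (((hasDerivAt_logKernel hL hy).const_mul (√(x ^ 2 + L ^ 2))⁻¹).fun_add
    ((hasDerivAt_div_sqrt_sq_add_sq hL y).const_mul (x / L ^ 2))).fun_sub
    ((hasDerivAt_sqrt_sq_add_sq hL y).fun_inv hr)
  refine h.congr_deriv ?_
  have e : √(y ^ 2 + L ^ 2) ^ 2 = y ^ 2 + L ^ 2 := Real.sq_sqrt (by positivity)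
  generalize √(y ^ 2 + L ^ 2) = r at *
  field_simp
  linear_combination e

lemma tendsto_cubeKernel_sub (hL : 0 < L) (x : ℝ) :
    Tendsto (fun ε => cubeKernel L x (x - ε) - cubeKernel L x (x + ε)) (𝓝[>] 0) (𝓝 0) := by
  set H : ℝ → ℝ := fun y => (√(x ^ 2 + L ^ 2))⁻¹
      * Real.log (L ^ 2 + x * y + √(x ^ 2 + L ^ 2) * √(y ^ 2 + L ^ 2))
      + x / L ^ 2 * (y / √(y ^ 2 + L ^ 2)) - (√(y ^ 2 + L ^ 2))⁻¹ with hH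
  have hc : Continuous H := by
    have hr : ∀ y : ℝ, √(y ^ 2 + L ^ 2) ≠ 0 := fun y => (sqrt_sq_add_sq_pos hL y).ne'
    have hs : Continuous fun y : ℝ => √(y ^ 2 + L ^ 2) := by fun_prop
    have hl : Continuous fun y : ℝ =>
        Real.log (L ^ 2 + x * y + √(x ^ 2 + L ^ 2) * √(y ^ 2 + L ^ 2)) :=
      Continuous.log (by fun_prop) fun y => (add_mul_add_sqrt_mul_sqrt_pos hL x y).ne'
    exact ((hl.const_mul _).add ((continuous_id.div hs hr).const_mul _)).sub (hs.inv₀ hr)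
  have h : Tendsto (fun ε => H (x - ε) - H (x + ε)) (𝓝[>] 0) (𝓝 (H (x - 0) - H (x + 0))) :=
    (Continuous.tendsto (by fun_prop) 0).mono_left nhdsWithin_le_nhds
  rw [sub_zero, add_zero, sub_self] at h
  refine h.congr fun ε => ?_
  have hlog : Real.log (x - (x + ε)) = Real.log (x - (x - ε)) := by
    rw [← Real.log_neg_eq_log]
    congr 1
    ring
  simp only [hH, cubeKernel, logKernel, hlog]
  ring

lemma integrableOn_uFunL_odd_mul_div (hL : 0 < L) (l : ℕ) (x : ℝ) {ε : ℝ} (hε : 0 < ε) :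
    IntegrableOn (fun y : ℝ => uFunL L (2 * (l : ℤ) + 1) y * (L / (y ^ 2 + L ^ 2))
      / ((x : ℂ) - y)) {y : ℝ | ε ≤ |x - y|} := by
  refine ((integrable_uFunL_odd_mul hL l).integrableOn.mul_bdd (c := ε⁻¹)
    (g := fun y : ℝ => ((x : ℂ) - y)⁻¹) ?_ ?_).congr (Eventually.of_forall fun y => ?_)
  · exact Measurable.aestronglyMeasurable (by fun_prop)
  · refine (ae_restrict_mem (measurableSet_le_abs_sub x ε)).mono fun y hy => ?_
    rw [norm_inv, ← Complex.ofReal_sub, Complex.norm_real, Real.norm_eq_abs]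
    exact inv_anti₀ hε hy
  · exact (div_eq_mul_inv _ _).symm

lemma hasPrincipalValue_uFunL_one (hL : 0 < L) (x : ℝ) :
    HasPrincipalValue
      (fun y => uFunL L (2 * ((0 : ℕ) : ℤ) + 1) y * (L / (y ^ 2 + L ^ 2)) / ((x : ℂ) - y)) x
      (-2 / L + ((x : ℂ) + Complex.I * L) * (L / (x ^ 2 + L ^ 2) *
        ((((√(x ^ 2 + L ^ 2))⁻¹ * (Real.log (x + √(x ^ 2 + L ^ 2))
          - Real.log (-x + √(x ^ 2 + L ^ 2))) + 2 * x / L ^ 2 : ℝ)) : ℂ))) := by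
  set F : ℝ → ℂ := fun y => -1 / L * ((y / √(y ^ 2 + L ^ 2) : ℝ) : ℂ)
    + ((x : ℂ) + Complex.I * L) * (L / (x ^ 2 + L ^ 2)) * (cubeKernel L x y : ℂ) with hF
  have hlim : ∀ {l : Filter ℝ} {c d : ℝ}, Tendsto (fun y : ℝ => y / √(y ^ 2 + L ^ 2)) l (𝓝 c) →
      Tendsto (logKernel L x) l (𝓝 d) → Tendsto (fun y : ℝ => |y|) l atTop →
      Tendsto F l (𝓝 (-1 / L * c + ((x : ℂ) + Complex.I * L) * (L / (x ^ 2 + L ^ 2))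
        * (((√(x ^ 2 + L ^ 2))⁻¹ * d + x / L ^ 2 * c - 0 : ℝ) : ℂ))) := by
    intro l c d hc hd hl
    have hk : Tendsto (cubeKernel L x) l (𝓝 _) :=
      ((hd.const_mul (√(x ^ 2 + L ^ 2))⁻¹).add (hc.const_mul (x / L ^ 2))).sub
      (tendsto_inv_sqrt_sq_add_sq L hl)
    exact (((Complex.continuous_ofReal.tendsto _).comp hc).const_mul _).add
      (((Complex.continuous_ofReal.tendsto _).comp hk).const_mul _)
  convert hasPrincipalValue_of_hasDerivAt (F := F)
    (fun ε hε => integrableOn_uFunL_odd_mul_div hL 0 x hε) ?_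
    (hlim (tendsto_div_sqrt_sq_add_sq_atBot L) (tendsto_logKernel_atBot hL x)
      tendsto_abs_atBot_atTop)
    (hlim (tendsto_div_sqrt_sq_add_sq_atTop L) (tendsto_logKernel_atTop hL x)
      tendsto_abs_atTop_atTop) ?_ using 1
  · push_cast
    ring
  · intro y hy
    have hxy : (x : ℂ) - y ≠ 0 := sub_ne_zero.mpr fun h => hy (Complex.ofReal_injective h).symm
    have hr0 : ((√(y ^ 2 + L ^ 2) : ℝ) : ℂ) ≠ 0 :=
      Complex.ofReal_ne_zero.mpr (sqrt_sq_add_sq_pos hL y).ne'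
    have hL0 : (L : ℂ) ≠ 0 := Complex.ofReal_ne_zero.mpr hL.ne'
    have hR : (x : ℂ) ^ 2 + (L : ℂ) ^ 2 ≠ 0 := by
      rw [← add_I_mul_mul_sub_I_mul]
      exact mul_ne_zero (ofReal_add_I_mul_ne_zero hL x) (ofReal_sub_I_mul_ne_zero hL x)
    refine (((hasDerivAt_div_sqrt_sq_add_sq hL y).ofReal_comp.const_mul (-1 / L : ℂ)).fun_add
      ((hasDerivAt_cubeKernel hL hy).ofReal_comp.const_mul
        (((x : ℂ) + Complex.I * L) * (L / (x ^ 2 + L ^ 2))))).congr_deriv ?_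
    rw [uFunL_odd hL, pow_zero, mul_one, ← ofReal_sqrt_sq L y]
    simp only [Complex.ofReal_div, Complex.ofReal_mul, Complex.ofReal_add, Complex.ofReal_sub,
      Complex.ofReal_pow]
    generalize ((√(y ^ 2 + L ^ 2) : ℝ) : ℂ) = r at *
    field_simp
    ring
  · have h1 : Tendsto (fun ε : ℝ => ((((x - ε) / √((x - ε) ^ 2 + L ^ 2)
        - (x + ε) / √((x + ε) ^ 2 + L ^ 2) : ℝ)) : ℂ)) (𝓝[>] 0) (𝓝 ((0 : ℝ) : ℂ)) := by
      have hr : ∀ y : ℝ, √(y ^ 2 + L ^ 2) ≠ 0 := fun y => (sqrt_sq_add_sq_pos hL y).ne'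
      refine (Complex.continuous_ofReal.tendsto _).comp ?_
      have := (Continuous.tendsto (f := fun ε : ℝ => (x - ε) / √((x - ε) ^ 2 + L ^ 2)
        - (x + ε) / √((x + ε) ^ 2 + L ^ 2)) (((by fun_prop : Continuous fun ε : ℝ => x - ε).div
          (by fun_prop) fun ε => hr _).sub ((by fun_prop : Continuous fun ε : ℝ => x + ε).div
          (by fun_prop) fun ε => hr _)) 0).mono_left (nhdsWithin_le_nhds (s := Set.Ioi 0))
      simpa using this
    have h2 := (Complex.continuous_ofReal.tendsto _).comp (tendsto_cubeKernel_sub hL x)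
    have h3 := (h1.const_mul (-1 / L : ℂ)).add (h2.const_mul
      (((x : ℂ) + Complex.I * L) * (L / (x ^ 2 + L ^ 2))))
    simp only [Complex.ofReal_zero, mul_zero, add_zero] at h3
    refine h3.congr fun ε => ?_
    simp only [hF, Function.comp_apply]
    push_cast
    ring

lemma sqrt_mul_cot_sq_add_sq (hL : 0 < L) {s : ℝ} (hs : 0 < Real.sin s) :
    √((L * Real.cot s) ^ 2 + L ^ 2) = L / Real.sin s := by
  rw [Real.sqrt_eq_iff_mul_self_eq (by positivity) (by positivity), Real.cot_eq_cos_div_sin]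
  field_simp
  linear_combination Real.sin_sq_add_cos_sq s

lemma log_mul_cot_add_sqrt_sub (hL : 0 < L) {s : ℝ} (hs : s ∈ Set.Ioo 0 Real.pi) :
    Real.log (L * Real.cot s + √((L * Real.cot s) ^ 2 + L ^ 2))
      - Real.log (-(L * Real.cot s) + √((L * Real.cot s) ^ 2 + L ^ 2))
      = 2 * Real.log (Real.cot (s / 2)) := by
  have hsin : 0 < Real.sin s := Real.sin_pos_of_mem_Ioo hs
  have h1 : 0 < Real.sin (s / 2) :=
    Real.sin_pos_of_pos_of_lt_pi (by linarith [hs.1]) (by linarith [hs.1, hs.2])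
  have h2 : 0 < Real.cos (s / 2) :=
    Real.cos_pos_of_mem_Ioo ⟨by linarith [hs.1, Real.pi_pos], by linarith [hs.2]⟩
  have hS : Real.sin s = 2 * Real.sin (s / 2) * Real.cos (s / 2) := by
    rw [← Real.sin_two_mul]; ring_nf
  have hC : Real.cos s = 2 * Real.cos (s / 2) ^ 2 - 1 := by
    rw [← Real.cos_two_mul]; ring_nf
  have hsq := Real.sin_sq_add_cos_sq (s / 2)
  have hcot : 0 < Real.cot (s / 2) := by
    rw [Real.cot_eq_cos_div_sin]; positivity
  have e1 : L * Real.cot s + L / Real.sin s = L * Real.cot (s / 2) := by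
    rw [Real.cot_eq_cos_div_sin, Real.cot_eq_cos_div_sin, hS, hC]
    field_simp
    ring
  have e2 : -(L * Real.cot s) + L / Real.sin s = L * (Real.cot (s / 2))⁻¹ := by
    rw [Real.cot_eq_cos_div_sin, Real.cot_eq_cos_div_sin, hS, hC]
    field_simp
    linear_combination -2 * hsq
  rw [sqrt_mul_cot_sq_add_sq hL hsin, e1, e2, Real.log_mul hL.ne' hcot.ne',
    Real.log_mul hL.ne' (inv_ne_zero hcot.ne'), Real.log_inv]
  ring

/-- `L / 2` times the principal value of `u_{2l+1}(y) L / ((y² + L²) (x - y))` at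
`x = L cot s`. -/
noncomputable def principalValueSum (s : ℝ) (l : ℕ) : ℂ :=
  1 / ((2 * l + 1) * (2 * l + 3))
    - 4 * ∑ m ∈ Finset.range (l + 1), 1 / ((2 * ((m : ℂ) - l) - 3) * (2 * ((m : ℂ) - l) - 1)
        * (2 * ((m : ℂ) - l) + 1)) * Complex.exp (s * Complex.I) ^ (2 * m)
    + ((Real.cos s + Real.sin s ^ 2 * Real.log (Real.cot (s / 2)) : ℝ) : ℂ)
      * Complex.exp (s * Complex.I) ^ (2 * l + 1)

lemma principalValueSum_succ (s : ℝ) (l : ℕ) :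
    principalValueSum s (l + 1) = Complex.exp (s * Complex.I) ^ 2 * principalValueSum s l
      - (Complex.exp (s * Complex.I) ^ 2 - 1) / ((2 * l + 1) * (2 * l + 3)) := by
  have h1 : (2 * l + 1 : ℂ) ≠ 0 := by exact_mod_cast (2 * l).succ_ne_zero
  have h3 : (2 * l + 3 : ℂ) ≠ 0 := by exact_mod_cast (2 * l + 2).succ_ne_zero
  have h5 : (2 * l + 5 : ℂ) ≠ 0 := by exact_mod_cast (2 * l + 4).succ_ne_zero
  have hq : 1 / ((2 * (((0 : ℕ) : ℂ) - ((l + 1 : ℕ) : ℂ)) - 3)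
      * (2 * (((0 : ℕ) : ℂ) - ((l + 1 : ℕ) : ℂ)) - 1)
      * (2 * (((0 : ℕ) : ℂ) - ((l + 1 : ℕ) : ℂ)) + 1))
      = -(1 / ((2 * l + 5) * (2 * l + 3) * (2 * l + 1)) : ℂ) := by
    rw [← div_neg]
    congr 1
    push_cast
    ring
  rw [principalValueSum, principalValueSum, Finset.sum_range_succ', hq]
  generalize ((Real.cos s + Real.sin s ^ 2 * Real.log (Real.cot (s / 2)) : ℝ) : ℂ) = A
  generalize Complex.exp (s * Complex.I) = e
  have hsum : ∑ m ∈ Finset.range (l + 1), 1 / ((2 * (((m + 1 : ℕ) : ℂ) - ((l + 1 : ℕ) : ℂ)) - 3)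
      * (2 * (((m + 1 : ℕ) : ℂ) - ((l + 1 : ℕ) : ℂ)) - 1)
      * (2 * (((m + 1 : ℕ) : ℂ) - ((l + 1 : ℕ) : ℂ)) + 1)) * e ^ (2 * (m + 1))
      = e ^ 2 * ∑ m ∈ Finset.range (l + 1), 1 / ((2 * ((m : ℂ) - l) - 3) * (2 * ((m : ℂ) - l) - 1)
        * (2 * ((m : ℂ) - l) + 1)) * e ^ (2 * m) := by
    rw [Finset.mul_sum]
    refine Finset.sum_congr rfl fun m _ => ?_
    push_cast
    rw [add_sub_add_right_eq_sub]
    ring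
  rw [hsum]
  generalize ∑ m ∈ Finset.range (l + 1), 1 / ((2 * ((m : ℂ) - l) - 3) * (2 * ((m : ℂ) - l) - 1)
        * (2 * ((m : ℂ) - l) + 1)) * e ^ (2 * m) = S
  have hl : (2 * ((l + 1 : ℕ) : ℂ) + 1) = 2 * l + 3 := by push_cast; ring
  have hl' : (2 * ((l + 1 : ℕ) : ℂ) + 3) = 2 * l + 5 := by push_cast; ring
  rw [hl, hl']
  field_simp
  ring

lemma exp_ofReal_mul_I_inv (s : ℝ) :
    (Complex.exp (s * Complex.I))⁻¹ = Complex.cos s - Complex.sin s * Complex.I := by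
  rw [← Complex.exp_neg, ← neg_mul, Complex.exp_mul_I, Complex.cos_neg, Complex.sin_neg]
  ring

lemma hasPrincipalValue_uFunL_odd (hL : 0 < L) {s : ℝ} (hs : s ∈ Set.Ioo 0 Real.pi) (l : ℕ) :
    HasPrincipalValue
      (fun y => uFunL L (2 * (l : ℤ) + 1) y * (L / (y ^ 2 + L ^ 2))
        / (((L * Real.cot s : ℝ) : ℂ) - y)) (L * Real.cot s) (2 / L * principalValueSum s l) := by
  have hsin : 0 < Real.sin s := Real.sin_pos_of_mem_Ioo hs
  have hS : Complex.sin s ≠ 0 := by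
    rw [← Complex.ofReal_sin]
    exact Complex.ofReal_ne_zero.mpr hsin.ne'
  have hL0 : (L : ℂ) ≠ 0 := Complex.ofReal_ne_zero.mpr hL.ne'
  have hxc : ((L * Real.cot s : ℝ) : ℂ) = L * Complex.cos s / Complex.sin s := by
    rw [Real.cot_eq_cos_div_sin]
    push_cast
    ring
  have he := Complex.exp_ne_zero (s * Complex.I)
  have hplus : ((L * Real.cot s : ℝ) : ℂ) + Complex.I * L
      = L / Complex.sin s * Complex.exp (s * Complex.I) := by
    rw [hxc, Complex.exp_mul_I]
    field_simp
  have hminus : ((L * Real.cot s : ℝ) : ℂ) - Complex.I * L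
      = L / Complex.sin s * (Complex.exp (s * Complex.I))⁻¹ := by
    rw [hxc, exp_ofReal_mul_I_inv]
    field_simp
  have hsub : Complex.exp (s * Complex.I) ^ 2 - 1
      = 2 * Complex.I * Complex.sin s * Complex.exp (s * Complex.I) := by
    have : Complex.exp (s * Complex.I) - (Complex.exp (s * Complex.I))⁻¹
        = 2 * Complex.I * Complex.sin s := by
      rw [exp_ofReal_mul_I_inv, Complex.exp_mul_I]
      ring
    rw [← this]
    field_simp
  induction l with
  | zero =>
    convert hasPrincipalValue_uFunL_one hL (L * Real.cot s) using 1
    rw [log_mul_cot_add_sqrt_sub hL hs, sqrt_mul_cot_sq_add_sq hL hsin, hplus,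
      ← ofReal_sqrt_sq, sqrt_mul_cot_sq_add_sq hL hsin, principalValueSum]
    push_cast
    rw [Finset.sum_range_one, Complex.cot_eq_cos_div_sin]
    field_simp
    norm_num
    ring
  | succ l ih =>
    convert ih.uFunL_odd_succ hL l using 1
    have h1 : (2 * l + 1 : ℂ) ≠ 0 := by exact_mod_cast (2 * l).succ_ne_zero
    have h3 : (2 * l + 3 : ℂ) ≠ 0 := by exact_mod_cast (2 * l + 2).succ_ne_zero
    rw [principalValueSum_succ, hsub, hplus, hminus]
    field_simp
    ring

end

/-- The cyclic convolution of `b̃` and `c̃` without wrap-around. -/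
lemma sum_mul_cyclic_eq {M P : ℕ} (hP : 2 * M + 1 ≤ P) (a bt ct : ℕ → ℂ)
    (hbt : ∀ l, bt l = if l ≤ M then (8 * (l : ℂ) + 4) * a l else 0)
    (hct : ∀ l, ct l = if l = 0 then 1 / 3 else if l ≤ P - M - 1 then 0
      else 1 / ((2 * ((l : ℂ) - (P : ℂ)) - 3) * (2 * ((l : ℂ) - (P : ℂ)) - 1)
        * (2 * ((l : ℂ) - (P : ℂ)) + 1))) {m : ℕ} (hm : m ≤ M) :
    ∑ n ∈ Finset.range P, bt n * ct ((((m : ℤ) - (n : ℤ)) % (P : ℤ)).toNat)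
      = ∑ n ∈ Finset.range (M + 1), (8 * (n : ℂ) + 4) * a n * if m ≤ n then
          1 / ((2 * ((m : ℂ) - n) - 3) * (2 * ((m : ℂ) - n) - 1) * (2 * ((m : ℂ) - n) + 1))
          else 0 := by
  rw [← Finset.sum_subset (Finset.range_subset_range.mpr (by lia : M + 1 ≤ P))]
  · refine Finset.sum_congr rfl fun n hn => ?_
    have hn : n ≤ M := by simpa [Nat.lt_succ_iff] using hn
    rw [hbt, if_pos hn]
    congr 1
    rcases lt_trichotomy m n with h | rfl | h
    · have hidx : (((m : ℤ) - (n : ℤ)) % (P : ℤ)).toNat = P + m - n := by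
        rw [← Int.add_emod_right, Int.emod_eq_of_lt (by lia) (by lia)]
        lia
      rw [hidx, hct, if_neg (by lia), if_neg (by lia), if_pos h.le,
        Nat.cast_sub (by lia), Nat.cast_add]
      ring_nf
    · simp only [sub_self, Int.zero_emod, Int.toNat_zero, hct, if_true, le_refl]
      norm_num
    · have hidx : (((m : ℤ) - (n : ℤ)) % (P : ℤ)).toNat = m - n := by
        rw [Int.emod_eq_of_lt (by lia) (by lia)]
        lia
      rw [hidx, hct, if_neg (by lia), if_pos (by lia), if_neg (by lia)]
  · intro n _ hn
    rw [hbt, if_neg (by simpa [Nat.lt_succ_iff] using hn), zero_mul]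

/-- Fast-convolution formula: for `L > 0`, `M ∈ ℕ`, coefficients `a₀,…,a_M ∈ ℂ`, `s ∈ (0,π)`,
`x = L·cot s` and `P ≥ 2M+1`, with `b̃`, `c̃` and the cyclic convolution
`(b̃∗c̃)_l = ∑_{n=0}^{P−1} b̃_n c̃_{(l−n) mod P}` as in the statement, the values
`v_l = (1/π)·PV∫ u_{2l+1}'(y)/(x−y) dy` all exist and satisfy
`∑_{l=0}^{M} a_l v_l = −(2i/(Lπ))∑ a_l/(2l+3) + (2i/(Lπ))∑ (b̃∗c̃)_l e^{i2ls}
 − (2i/(Lπ))(cos s + sin² s·ln(cot(s/2)))∑ (2l+1)a_l e^{i(2l+1)s}`. -/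
theorem fast_convolution_halfLaplacian_pos (L : ℝ) (hL : 0 < L) (M : ℕ) (a : ℕ → ℂ)
    (s : ℝ) (hs : s ∈ Set.Ioo 0 Real.pi) (x : ℝ) (hx : x = L * Real.cot s)
    (P : ℕ) (hP : 2 * M + 1 ≤ P) (bt ct : ℕ → ℂ)
    (hbt : ∀ l, bt l = if l ≤ M then (8 * (l : ℂ) + 4) * a l else 0)
    (hct : ∀ l, ct l = if l = 0 then 1 / 3 else if l ≤ P - M - 1 then 0
      else 1 / ((2 * ((l : ℂ) - (P : ℂ)) - 3) * (2 * ((l : ℂ) - (P : ℂ)) - 1)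
        * (2 * ((l : ℂ) - (P : ℂ)) + 1))) :
    ∃ v : ℕ → ℂ,
      (∀ l ∈ Finset.range (M + 1),
        Tendsto (fun ε : ℝ => (1 / (Real.pi : ℂ)) *
            ∫ y in {y : ℝ | ε ≤ |x - y|},
              deriv (uFunL L (2 * (l : ℤ) + 1)) y / ((x : ℂ) - (y : ℂ)))
          (nhdsWithin 0 (Set.Ioi 0)) (nhds (v l)))
      ∧ ∑ l ∈ Finset.range (M + 1), a l * v l
        = -(2 * Complex.I / ((L : ℂ) * (Real.pi : ℂ)))
              * ∑ l ∈ Finset.range (M + 1), a l / (2 * (l : ℂ) + 3)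
          + (2 * Complex.I / ((L : ℂ) * (Real.pi : ℂ)))
              * ∑ l ∈ Finset.range (M + 1),
                  (∑ n ∈ Finset.range P, bt n * ct ((((l : ℤ) - (n : ℤ)) % (P : ℤ)).toNat))
                    * Complex.exp (Complex.I * 2 * (l : ℂ) * (s : ℂ))
          - (2 * Complex.I / ((L : ℂ) * (Real.pi : ℂ)))
              * ((Real.cos s + (Real.sin s) ^ 2 * Real.log (Real.cot (s / 2)) : ℝ) : ℂ)
              * ∑ l ∈ Finset.range (M + 1),
                  (2 * (l : ℂ) + 1) * a l
                    * Complex.exp (Complex.I * (2 * (l : ℂ) + 1) * (s : ℂ)) := by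
  refine ⟨fun l => 1 / (Real.pi : ℂ) * (-Complex.I * (2 * l + 1)
    * (2 / L * principalValueSum s l)), fun l _ => ?_, ?_⟩
  · subst hx
    refine ((((hasPrincipalValue_uFunL_odd hL hs l).const_mul
      (-Complex.I * (2 * l + 1))).2).const_mul (1 / (Real.pi : ℂ))).congr fun ε => ?_
    simp only [(hasDerivAt_uFunL_odd hL l _).deriv, mul_div_assoc]
  · have hpi : (Real.pi : ℂ) ≠ 0 := Complex.ofReal_ne_zero.mpr Real.pi_ne_zero
    have hL0 : (L : ℂ) ≠ 0 := Complex.ofReal_ne_zero.mpr hL.ne'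
    have hconv : ∑ l ∈ Finset.range (M + 1),
        (∑ n ∈ Finset.range P, bt n * ct ((((l : ℤ) - (n : ℤ)) % (P : ℤ)).toNat))
          * Complex.exp (Complex.I * 2 * (l : ℂ) * (s : ℂ))
        = ∑ l ∈ Finset.range (M + 1), (8 * (l : ℂ) + 4) * a l
          * ∑ m ∈ Finset.range (l + 1), 1 / ((2 * ((m : ℂ) - l) - 3) * (2 * ((m : ℂ) - l) - 1)
            * (2 * ((m : ℂ) - l) + 1)) * Complex.exp (s * Complex.I) ^ (2 * m) := by
      rw [Finset.sum_congr rfl fun l hl => by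
        rw [sum_mul_cyclic_eq hP a bt ct hbt hct (Nat.lt_succ_iff.mp (Finset.mem_range.mp hl)),
          Finset.sum_mul], Finset.sum_comm]
      refine Finset.sum_congr rfl fun n hn => ?_
      rw [Finset.mul_sum]
      symm
      refine (Finset.sum_congr rfl fun m hm => ?_).trans
        (Finset.sum_subset (Finset.range_subset_range.mpr
          (Nat.succ_le_of_lt (Finset.mem_range.mp hn))) fun m _ hm => ?_)
      · rw [if_pos (Nat.lt_succ_iff.mp (Finset.mem_range.mp hm)), ← Complex.exp_nat_mul, mul_assoc]
        push_cast
        ring_nf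
      · rw [if_neg (by simpa [Nat.lt_succ_iff] using hm), mul_zero, zero_mul]
    rw [hconv, Finset.mul_sum, Finset.mul_sum, Finset.mul_sum, ← Finset.sum_add_distrib,
      ← Finset.sum_sub_distrib]
    refine Finset.sum_congr rfl fun l _ => ?_
    have hexp : Complex.exp (Complex.I * (2 * (l : ℂ) + 1) * (s : ℂ))
        = Complex.exp (s * Complex.I) ^ (2 * l + 1) := by
      rw [← Complex.exp_nat_mul]
      push_cast
      ring_nf
    have h1 : (2 * l + 1 : ℂ) ≠ 0 := by exact_mod_cast (2 * l).succ_ne_zero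
    have h3 : (2 * l + 3 : ℂ) ≠ 0 := by exact_mod_cast (2 * l + 2).succ_ne_zero
    simp only [hexp, principalValueSum]
    generalize ∑ m ∈ Finset.range (l + 1), 1 / ((2 * ((m : ℂ) - l) - 3) * (2 * ((m : ℂ) - l) - 1)
      * (2 * ((m : ℂ) - l) + 1)) * Complex.exp (s * Complex.I) ^ (2 * m) = S
    field_simp
    ring
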